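/- Let V be a Whittaker module for U_q(f_m(K)) with cyclic Whittaker vector. Then End_{U_q(f_m(K))}(V) is isomorphic as an algebra to Z(U_q(f_m(K)))/Z_V, where Z_V = Ann(V) ∩ Z(U_q(f_m(K))); in particular End_{U_q(f_m(K))}(V) is commutative. -/

import Mathlib

noncomputable section

inductive UqGen : Type
  | E : UqGen
  | F : UqGen
  | K : UqGen
  | Kinv : UqGen

def lpow {A : Type*} [Monoid A] (x xinv : A) (n : ℤ) : A :=
  if 0 ≤ n then x ^ n.toNat else xinv ^ (-n).toNat

open FreeAlgebra in
inductive UqRel (q : ℂ) (m : ℕ) : FreeAlgebra ℂ UqGen → FreeAlgebra ℂ UqGen → Prop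
  | KE : UqRel q m (ι ℂ UqGen.K * ι ℂ UqGen.E) (q ^ 2 • (ι ℂ UqGen.E * ι ℂ UqGen.K))
  | KF : UqRel q m (ι ℂ UqGen.K * ι ℂ UqGen.F) ((q ^ 2)⁻¹ • (ι ℂ UqGen.F * ι ℂ UqGen.K))
  | KKinv : UqRel q m (ι ℂ UqGen.K * ι ℂ UqGen.Kinv) 1
  | KinvK : UqRel q m (ι ℂ UqGen.Kinv * ι ℂ UqGen.K) 1
  | EF : UqRel q m (ι ℂ UqGen.E * ι ℂ UqGen.F - ι ℂ UqGen.F * ι ℂ UqGen.E)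
      ((q - q⁻¹)⁻¹ • ((ι ℂ UqGen.K) ^ m - (ι ℂ UqGen.Kinv) ^ m))

abbrev Uq (q : ℂ) (m : ℕ) : Type := RingQuot (UqRel q m)

def Egen (q : ℂ) (m : ℕ) : Uq q m := RingQuot.mkAlgHom ℂ (UqRel q m) (FreeAlgebra.ι ℂ UqGen.E)
def Fgen (q : ℂ) (m : ℕ) : Uq q m := RingQuot.mkAlgHom ℂ (UqRel q m) (FreeAlgebra.ι ℂ UqGen.F)
def Kgen (q : ℂ) (m : ℕ) : Uq q m := RingQuot.mkAlgHom ℂ (UqRel q m) (FreeAlgebra.ι ℂ UqGen.K)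
def Kinvgen (q : ℂ) (m : ℕ) : Uq q m := RingQuot.mkAlgHom ℂ (UqRel q m) (FreeAlgebra.ι ℂ UqGen.Kinv)

def Kzpow (q : ℂ) (m : ℕ) (n : ℤ) : Uq q m := lpow (Kgen q m) (Kinvgen q m) n

def Casimir (q : ℂ) (m : ℕ) : Uq q m :=
  Fgen q m * Egen q m +
    (((q ^ (2 * m) - 1) * (q - q⁻¹))⁻¹ * q ^ (2 * m)) • Kgen q m ^ m +
    ((q ^ (2 * m) - 1) * (q - q⁻¹))⁻¹ • Kinvgen q m ^ m


section Relations

variable (q : ℂ) (m : ℕ)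

theorem Kgen_mul_Egen : Kgen q m * Egen q m = q ^ 2 • (Egen q m * Kgen q m) := by
  simpa [Kgen, Egen] using RingQuot.mkAlgHom_rel ℂ (UqRel.KE (q := q) (m := m))

theorem Kgen_mul_Fgen : Kgen q m * Fgen q m = (q ^ 2)⁻¹ • (Fgen q m * Kgen q m) := by
  simpa [Kgen, Fgen] using RingQuot.mkAlgHom_rel ℂ (UqRel.KF (q := q) (m := m))

theorem Kgen_mul_Kinvgen : Kgen q m * Kinvgen q m = 1 := by
  simpa [Kgen, Kinvgen] using RingQuot.mkAlgHom_rel ℂ (UqRel.KKinv (q := q) (m := m))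

theorem Kinvgen_mul_Kgen : Kinvgen q m * Kgen q m = 1 := by
  simpa [Kgen, Kinvgen] using RingQuot.mkAlgHom_rel ℂ (UqRel.KinvK (q := q) (m := m))

theorem Egen_mul_Fgen : Egen q m * Fgen q m =
    Fgen q m * Egen q m + (q - q⁻¹)⁻¹ • (Kgen q m ^ m - Kinvgen q m ^ m) := by
  have h : Egen q m * Fgen q m - Fgen q m * Egen q m =
      (q - q⁻¹)⁻¹ • (Kgen q m ^ m - Kinvgen q m ^ m) := by
    simpa [Egen, Fgen, Kgen, Kinvgen] using RingQuot.mkAlgHom_rel ℂ (UqRel.EF (q := q) (m := m))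
  rw [← h]; abel

/-- The generator `K` as a unit of `Uq q m`. -/
def Kunit : (Uq q m)ˣ where
  val := Kgen q m
  inv := Kinvgen q m
  val_inv := Kgen_mul_Kinvgen q m
  inv_val := Kinvgen_mul_Kgen q m

variable {q m}

/-- A subalgebra of `Uq q m` containing the four generators is everything. -/
theorem mem_of_generators_mem {S : Subalgebra ℂ (Uq q m)} (hE : Egen q m ∈ S)
    (hF : Fgen q m ∈ S) (hK : Kgen q m ∈ S) (hKinv : Kinvgen q m ∈ S) (u : Uq q m) : u ∈ S := by
  obtain ⟨x, rfl⟩ := RingQuot.mkAlgHom_surjective ℂ (UqRel q m) u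
  induction x using FreeAlgebra.induction with
  | grade0 r => rw [AlgHom.commutes]; exact S.algebraMap_mem r
  | grade1 g => cases g <;> assumption
  | mul a b ha hb => rw [map_mul]; exact S.mul_mem ha hb
  | add a b ha hb => rw [map_add]; exact S.add_mem ha hb

end Relations

section SkewCommutation

variable {A : Type*} [Ring A] [Algebra ℂ A]

theorem pow_mul_of_skew {k x : A} {t : ℂ} (h : k * x = t • (x * k)) (n : ℕ) :
    k ^ n * x = t ^ n • (x * k ^ n) := by
  induction n with
  | zero => simp
  | succ n ih =>
    rw [pow_succ, mul_assoc, h, mul_smul_comm, ← mul_assoc, ih, smul_mul_assoc, smul_smul,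
      mul_assoc, pow_succ t, mul_comm t]

theorem inv_mul_of_skew {k k' x : A} {t : ℂ} (ht : t ≠ 0) (hk : k * k' = 1) (hk' : k' * k = 1)
    (h : k * x = t • (x * k)) : k' * x = t⁻¹ • (x * k') := by
  have h' : k' * (k * x) * k' = t • (k' * (x * k) * k') := by
    rw [h, mul_smul_comm, smul_mul_assoc]
  have e1 : k' * (k * x) * k' = x * k' := by rw [← mul_assoc, hk', one_mul]
  have e2 : k' * (x * k) * k' = k' * x := by rw [mul_assoc, mul_assoc, hk, mul_one]
  rw [e1, e2] at h'
  rw [h', smul_smul, inv_mul_cancel₀ ht, one_smul]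

end SkewCommutation

section Centre

variable {q : ℂ} {m : ℕ}

theorem Kinvgen_mul_Egen (hq0 : q ≠ 0) :
    Kinvgen q m * Egen q m = (q ^ 2)⁻¹ • (Egen q m * Kinvgen q m) :=
  inv_mul_of_skew (pow_ne_zero 2 hq0) (Kgen_mul_Kinvgen q m) (Kinvgen_mul_Kgen q m)
    (Kgen_mul_Egen q m)

theorem Kinvgen_mul_Fgen (hq0 : q ≠ 0) :
    Kinvgen q m * Fgen q m = q ^ 2 • (Fgen q m * Kinvgen q m) := by
  simpa using inv_mul_of_skew (inv_ne_zero (pow_ne_zero 2 hq0)) (Kgen_mul_Kinvgen q m)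
    (Kinvgen_mul_Kgen q m) (Kgen_mul_Fgen q m)

theorem sub_inv_ne_zero_of_sq_ne_one (hq0 : q ≠ 0) (h2 : q ^ 2 ≠ 1) : q - q⁻¹ ≠ 0 := by
  intro h
  apply h2
  field_simp at h
  linear_combination h

theorem Casimir_mul_Egen (hq0 : q ≠ 0) (h2 : q ^ 2 ≠ 1) (h2m : q ^ (2 * m) ≠ 1) :
    Casimir q m * Egen q m = Egen q m * Casimir q m := by
  have hd := sub_inv_ne_zero_of_sq_ne_one hq0 h2
  have hm := sub_ne_zero.2 h2m
  have hK := pow_mul_of_skew (Kgen_mul_Egen q m) m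
  have hL := pow_mul_of_skew (Kinvgen_mul_Egen (m := m) hq0) m
  rw [inv_pow] at hL
  rw [← pow_mul] at hK hL
  have hEFE : Egen q m * (Fgen q m * Egen q m) = Fgen q m * Egen q m * Egen q m +
      (q - q⁻¹)⁻¹ • (q ^ (2 * m) • (Egen q m * Kgen q m ^ m) -
        (q ^ (2 * m))⁻¹ • (Egen q m * Kinvgen q m ^ m)) := by
    rw [← mul_assoc, Egen_mul_Fgen, add_mul, smul_mul_assoc, sub_mul, hK, hL]
  simp only [Casimir, add_mul, mul_add, smul_mul_assoc, mul_smul_comm, hK, hL, hEFE]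
  have hp : q ^ (2 * m) ≠ 0 := pow_ne_zero _ hq0
  generalize q ^ (2 * m) = p at *
  generalize q - q⁻¹ = d at *
  match_scalars <;> field_simp <;> ring

theorem Casimir_mul_Fgen (hq0 : q ≠ 0) (h2 : q ^ 2 ≠ 1) (h2m : q ^ (2 * m) ≠ 1) :
    Casimir q m * Fgen q m = Fgen q m * Casimir q m := by
  have hd := sub_inv_ne_zero_of_sq_ne_one hq0 h2
  have hm := sub_ne_zero.2 h2m
  have hK := pow_mul_of_skew (Kgen_mul_Fgen q m) m
  have hL := pow_mul_of_skew (Kinvgen_mul_Fgen (m := m) hq0) m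
  rw [inv_pow] at hK
  rw [← pow_mul] at hK hL
  have hFEF : Fgen q m * Egen q m * Fgen q m = Fgen q m * (Fgen q m * Egen q m) +
      (q - q⁻¹)⁻¹ • (Fgen q m * Kgen q m ^ m - Fgen q m * Kinvgen q m ^ m) := by
    rw [mul_assoc, Egen_mul_Fgen, mul_add, mul_smul_comm, mul_sub]
  simp only [Casimir, add_mul, mul_add, smul_mul_assoc, mul_smul_comm, hK, hL, hFEF]
  have hp : q ^ (2 * m) ≠ 0 := pow_ne_zero _ hq0
  generalize q ^ (2 * m) = p at *
  generalize q - q⁻¹ = d at *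
  match_scalars <;> field_simp <;> ring

theorem Casimir_mul_Kgen (hq0 : q ≠ 0) :
    Casimir q m * Kgen q m = Kgen q m * Casimir q m := by
  have hFE : Commute (Fgen q m * Egen q m) (Kgen q m) := by
    change _ = Kgen q m * (Fgen q m * Egen q m)
    rw [← mul_assoc (Kgen q m), Kgen_mul_Fgen, smul_mul_assoc, mul_assoc, mul_assoc,
      Kgen_mul_Egen, mul_smul_comm, smul_smul, inv_mul_cancel₀ (pow_ne_zero 2 hq0), one_smul]
  have hL : Commute (Kinvgen q m) (Kgen q m) :=
    (Kinvgen_mul_Kgen q m).trans (Kgen_mul_Kinvgen q m).symm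
  exact (hFE.add_left (((Commute.refl _).pow_left m).smul_left _)).add_left
    ((hL.pow_left m).smul_left _)

theorem Casimir_mem_center (hq0 : q ≠ 0) (h2 : q ^ 2 ≠ 1) (h2m : q ^ (2 * m) ≠ 1) :
    Casimir q m ∈ Subalgebra.center ℂ (Uq q m) := by
  have hK : Commute (Casimir q m) (Kunit q m) := Casimir_mul_Kgen hq0
  rw [Subalgebra.mem_center_iff]
  intro u
  have hu : u ∈ Subalgebra.centralizer ℂ {Casimir q m} := by
    apply mem_of_generators_mem <;>
      simp only [Subalgebra.mem_centralizer_iff, Set.mem_singleton_iff, forall_eq]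
    · exact Casimir_mul_Egen hq0 h2 h2m
    · exact Casimir_mul_Fgen hq0 h2 h2m
    · exact hK
    · exact hK.units_inv_right
  exact ((Subalgebra.mem_centralizer_iff ℂ).1 hu _ rfl).symm

end Centre

section Whittaker

variable {q : ℂ} {m : ℕ} {V : Type*} [AddCommGroup V] [Module (Uq q m) V]

theorem center_smul_comm (z : Subalgebra.center ℂ (Uq q m)) (u : Uq q m) (v : V) :
    u • z • v = z • u • v := by
  change u • (z : Uq q m) • v = (z : Uq q m) • u • v
  rw [smul_smul, smul_smul, Subalgebra.mem_center_iff.1 z.2 u]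

variable [Module ℂ V] [IsScalarTower ℂ (Uq q m) V]

theorem Egen_smul_Kgen_smul (hq0 : q ≠ 0) {a : ℂ} {v : V} (h : Egen q m • v = a • v) :
    Egen q m • Kgen q m • v = (a * (q ^ 2)⁻¹) • Kgen q m • v := by
  have h' : Egen q m * Kgen q m = (q ^ 2)⁻¹ • (Kgen q m * Egen q m) := by
    rw [Kgen_mul_Egen, smul_smul, inv_mul_cancel₀ (pow_ne_zero 2 hq0), one_smul]
  rw [smul_smul, h', smul_assoc, mul_smul, h, smul_comm (Kgen q m) a v, smul_smul, mul_comm]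

theorem Egen_smul_Kinvgen_smul (hq0 : q ≠ 0) {a : ℂ} {v : V} (h : Egen q m • v = a • v) :
    Egen q m • Kinvgen q m • v = (a * q ^ 2) • Kinvgen q m • v := by
  have h' : Egen q m * Kinvgen q m = q ^ 2 • (Kinvgen q m * Egen q m) := by
    rw [Kinvgen_mul_Egen hq0, smul_smul, mul_inv_cancel₀ (pow_ne_zero 2 hq0), one_smul]
  rw [smul_smul, h', smul_assoc, mul_smul, h, smul_comm (Kinvgen q m) a v, smul_smul, mul_comm]

/-- If `w` is an `E`-eigenvector, so is `K ^ n w`, with eigenvalue scaled by `q ^ (-2n)`. -/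
theorem Egen_smul_Kunit_zpow_smul (hq0 : q ≠ 0) {e : ℂ} {w : V} (hw : Egen q m • w = e • w)
    (n : ℤ) : Egen q m • (Kunit q m ^ n) • w = (e * (q ^ 2) ^ (-n)) • (Kunit q m ^ n) • w := by
  have hp : q ^ 2 ≠ 0 := pow_ne_zero 2 hq0
  induction n with
  | zero => simpa using hw
  | succ n ih =>
    have ha : e * (q ^ 2) ^ (-(1 + n : ℤ)) = e * (q ^ 2) ^ (-n : ℤ) * (q ^ 2)⁻¹ := by
      rw [neg_add, zpow_add₀ hp, zpow_neg_one]; ring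
    rw [add_comm, zpow_add, zpow_one, mul_smul, ha]
    exact Egen_smul_Kgen_smul hq0 ih
  | pred n ih =>
    have ha : e * (q ^ 2) ^ (-(-1 + -n : ℤ)) = e * (q ^ 2) ^ (-(-n) : ℤ) * q ^ 2 := by
      rw [neg_add, neg_neg, zpow_add₀ hp, zpow_one]; ring
    rw [sub_eq_neg_add, zpow_add, zpow_neg_one, mul_smul, ha]
    exact Egen_smul_Kinvgen_smul hq0 ih

/-- On an `E`-eigenvector with nonzero eigenvalue, `F` acts through the Casimir element and `K`. -/
theorem Fgen_smul_of_eigenvector {a : ℂ} (ha : a ≠ 0) {v : V} (h : Egen q m • v = a • v) :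
    Fgen q m • v = a⁻¹ • (Casimir q m • v -
      (((q ^ (2 * m) - 1) * (q - q⁻¹))⁻¹ * q ^ (2 * m)) • Kgen q m ^ m • v -
      ((q ^ (2 * m) - 1) * (q - q⁻¹))⁻¹ • Kinvgen q m ^ m • v) := by
  have hFE : (Fgen q m * Egen q m) • v = a • Fgen q m • v := by
    rw [mul_smul, h, smul_comm]
  rw [Casimir, add_smul, add_smul, hFE, smul_assoc, smul_assoc, add_sub_right_comm,
    add_sub_cancel_right, add_sub_cancel_right, smul_smul, inv_mul_cancel₀ ha, one_smul]

/-- A cyclic Whittaker module is generated over the centre by the vectors `K ^ n w`. -/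
theorem mem_span_center_Kunit_zpow (hq0 : q ≠ 0) (h2 : q ^ 2 ≠ 1) (h2m : q ^ (2 * m) ≠ 1)
    {e : ℂ} (he : e ≠ 0) {w : V} (hw : Egen q m • w = e • w) (u : Uq q m) :
    u • w ∈ Submodule.span (Subalgebra.center ℂ (Uq q m))
      (Set.range fun n : ℤ => (Kunit q m ^ n) • w) := by
  set W := Submodule.span (Subalgebra.center ℂ (Uq q m))
    (Set.range fun n : ℤ => (Kunit q m ^ n) • w)
  have hgen (n : ℤ) : (Kunit q m ^ n) • w ∈ W := Submodule.subset_span ⟨n, rfl⟩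
  have hC (c : ℂ) {v : V} (hv : v ∈ W) : c • v ∈ W := by
    rw [← algebraMap_smul (Uq q m) c v]
    exact W.smul_mem (algebraMap ℂ (Subalgebra.center ℂ (Uq q m)) c) hv
  have hstable (x : Uq q m) (hx : ∀ n : ℤ, x • (Kunit q m ^ n) • w ∈ W) (v : V) (hv : v ∈ W) :
      x • v ∈ W := by
    induction hv using Submodule.span_induction with
    | mem v hv => obtain ⟨n, rfl⟩ := hv; exact hx n
    | zero => rw [smul_zero]; exact W.zero_mem
    | add a b _ _ ha hb => rw [smul_add]; exact W.add_mem ha hb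
    | smul z a _ ha => rw [center_smul_comm]; exact W.smul_mem z ha
  let S : Subalgebra ℂ (Uq q m) :=
    { carrier := {x | ∀ v ∈ W, x • v ∈ W}
      mul_mem' := fun ha hb v hv => by rw [mul_smul]; exact ha _ (hb v hv)
      add_mem' := fun ha hb v hv => by rw [add_smul]; exact W.add_mem (ha v hv) (hb v hv)
      algebraMap_mem' := fun c v hv => by rw [algebraMap_smul]; exact hC c hv }
  have hu : u ∈ S := by
    apply mem_of_generators_mem
    · refine hstable _ fun n => ?_
      rw [Egen_smul_Kunit_zpow_smul hq0 hw]
      exact hC _ (hgen n)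
    · refine hstable _ fun n => ?_
      have ha : e * (q ^ 2) ^ (-n) ≠ 0 := mul_ne_zero he (zpow_ne_zero _ (pow_ne_zero 2 hq0))
      rw [Fgen_smul_of_eigenvector ha (Egen_smul_Kunit_zpow_smul hq0 hw n)]
      rw [sub_eq_add_neg, sub_eq_add_neg, ← neg_smul, ← neg_smul]
      refine hC _ (W.add_mem (W.add_mem ?_ (hC _ ?_)) (hC _ ?_))
      · exact W.smul_mem ⟨_, Casimir_mem_center hq0 h2 h2m⟩ (hgen n)
      · change (Kunit q m ^ m) • _ ∈ W
        rw [smul_smul, ← zpow_natCast, ← zpow_add]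
        exact hgen _
      · change ((Kunit q m)⁻¹ ^ m) • _ ∈ W
        rw [smul_smul, ← zpow_natCast, inv_zpow', ← zpow_add]
        exact hgen _
    · refine hstable _ fun n => ?_
      change Kunit q m • _ ∈ W
      rw [smul_smul, ← zpow_one_add]
      exact hgen _
    · refine hstable _ fun n => ?_
      change (Kunit q m)⁻¹ • _ ∈ W
      rw [smul_smul, ← zpow_neg_one, ← zpow_add]
      exact hgen _
  simpa using hu _ (hgen 0)

/-- Every Whittaker vector of a cyclic Whittaker module is a central multiple of the generator. -/
theorem exists_center_smul_eq (hq0 : q ≠ 0) (hq : ∀ k : ℕ, 0 < k → q ^ k ≠ 1) (hm : 1 ≤ m)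
    {e : ℂ} (he : e ≠ 0) {w : V} (hw : Egen q m • w = e • w) (u : Uq q m)
    (hu : Egen q m • u • w = e • u • w) :
    ∃ z : Subalgebra.center ℂ (Uq q m), u • w = z • w := by
  have hspan := mem_span_center_Kunit_zpow hq0 (hq 2 two_pos) (hq (2 * m) (by omega)) he hw u
  obtain ⟨c, hc⟩ := Finsupp.mem_span_range_iff_exists_finsupp.1 hspan
  refine ⟨c 0, ?_⟩
  let T : Module.End ℂ V := Module.toModuleEnd ℂ V (Egen q m)
  have hT (n : ℤ) : c n • (Kunit q m ^ n) • w ∈ T.eigenspace (e * (q ^ 2) ^ (-n)) := by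
    rw [Module.End.mem_eigenspace_iff]
    change Egen q m • c n • (Kunit q m ^ n) • w = _
    rw [center_smul_comm, Egen_smul_Kunit_zpow_smul hq0 hw]
    exact smul_comm (c n : Uq q m) (e * (q ^ 2) ^ (-n)) _
  have hne {n : ℤ} (hn : n ≠ 0) : e * (q ^ 2) ^ (-n) ≠ e := by
    intro h
    have h1 : (q ^ 2) ^ (-n) = 1 := mul_left_cancel₀ he (h.trans (mul_one e).symm)
    have h2 : (q ^ 2) ^ n.natAbs = 1 := by
      rcases Int.natAbs_eq n with h' | h' <;> rw [h'] at h1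
      · rwa [zpow_neg, inv_eq_one, zpow_natCast] at h1
      · rwa [neg_neg, zpow_natCast] at h1
    rw [← pow_mul] at h2
    exact hq _ (by omega) h2
  have hsplit : u • w - c 0 • w =
      (c.erase 0).sum fun n z => z • (Kunit q m ^ n) • w := by
    rw [← hc, ← Finsupp.add_sum_erase' c 0 (fun n z => z • (Kunit q m ^ n) • w)
      fun n => zero_smul _ _, zpow_zero, one_smul,
      add_sub_cancel_left]
  have hmem₀ : u • w - c 0 • w ∈ T.eigenspace e := by
    refine Submodule.sub_mem _ (Module.End.mem_eigenspace_iff.2 hu) ?_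
    simpa using hT 0
  have hmem₁ : u • w - c 0 • w ∈ ⨆ ν, ⨆ (_ : ν ≠ e), T.eigenspace ν := by
    rw [hsplit]
    refine Submodule.sum_mem _ fun n hn => ?_
    have hn0 : n ≠ 0 := by
      rintro rfl
      simp at hn
    rw [Finsupp.erase_ne hn0]
    exact Submodule.mem_iSup_of_mem _ (Submodule.mem_iSup_of_mem (hne hn0) (hT n))
  exact sub_eq_zero.1
    (Submodule.disjoint_def.1 (T.eigenspaces_iSupIndep e) _ hmem₀ hmem₁)

end Whittaker

/-- Let `V` be a Whittaker module for `U_q(f_m(K))` with cyclic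
Whittaker vector `w`. Then `End_{U_q(f_m(K))}(V)` is isomorphic as an algebra to
`Z(U_q(f_m(K)))/Z_V` where `Z_V = Ann(V) ∩ Z(U_q(f_m(K)))`: the natural ring
homomorphism `Z(U_q(f_m(K))) → End_{U_q(f_m(K))}(V)`, `z ↦ (v ↦ z • v)`, is
surjective with kernel `Z_V`. In particular `End_{U_q(f_m(K))}(V)` is commutative. -/
theorem stmt16 (q : ℂ) (m : ℕ) (hm : 1 ≤ m) (hq0 : q ≠ 0)
    (hq : ∀ k : ℕ, 0 < k → q ^ k ≠ 1)
    (e : ℂ) (he : e ≠ 0)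
    (V : Type) [AddCommGroup V] [Module (Uq q m) V]
    (w : V) (hw0 : w ≠ 0)
    (hw : Egen q m • w = algebraMap ℂ (Uq q m) e • w)
    (hcyc : ∀ v : V, ∃ u : Uq q m, v = u • w) :
    (∀ φ ψ : Module.End (Uq q m) V, φ * ψ = ψ * φ) ∧
    ∃ Φ : ↥(Subalgebra.center ℂ (Uq q m)) →+* Module.End (Uq q m) V,
      (∀ (z : ↥(Subalgebra.center ℂ (Uq q m))) (v : V), Φ z v = (z : Uq q m) • v) ∧
      Function.Surjective Φ ∧
      (∀ z : ↥(Subalgebra.center ℂ (Uq q m)),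
        Φ z = 0 ↔ ∀ v : V, (z : Uq q m) • v = 0) := by
  have hwhit (φ : Module.End (Uq q m) V) :
      ∃ z : Subalgebra.center ℂ (Uq q m), ∀ v, φ v = (z : Uq q m) • v := by
    let _ : Module ℂ V := Module.compHom V (algebraMap ℂ (Uq q m))
    have _ : IsScalarTower ℂ (Uq q m) V :=
      ⟨fun c u v => by rw [Algebra.smul_def, mul_smul]; rfl⟩
    obtain ⟨u, hu⟩ := hcyc (φ w)
    have hφ : Egen q m • u • w = e • u • w := by
      rw [← hu, ← map_smul, hw, map_smul, algebraMap_smul]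
    obtain ⟨z, hz⟩ := exists_center_smul_eq hq0 hq hm he (hw.trans (algebraMap_smul _ e w)) u hφ
    refine ⟨z, fun v => ?_⟩
    obtain ⟨x, rfl⟩ := hcyc v
    rw [map_smul, hu, hz, center_smul_comm]
    rfl
  let Φ : Subalgebra.center ℂ (Uq q m) →+* Module.End (Uq q m) V :=
    { toFun := fun z =>
        { toFun := fun v => (z : Uq q m) • v
          map_add' := smul_add _
          map_smul' := fun u v => by
            rw [RingHom.id_apply, smul_smul, smul_smul, Subalgebra.mem_center_iff.1 z.2 u] }
      map_one' := LinearMap.ext fun v => one_smul _ v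
      map_mul' := fun a b => LinearMap.ext fun v => mul_smul (a : Uq q m) b v
      map_zero' := LinearMap.ext fun v => zero_smul _ v
      map_add' := fun a b => LinearMap.ext fun v => add_smul (a : Uq q m) b v }
  have hΦ : Function.Surjective Φ := fun φ =>
    (hwhit φ).imp fun z hz => LinearMap.ext fun v => (hz v).symm
  refine ⟨fun φ ψ => ?_, Φ, fun _ _ => rfl, hΦ, fun z => LinearMap.ext_iff⟩
  obtain ⟨a, rfl⟩ := hΦ φ
  obtain ⟨b, rfl⟩ := hΦ ψ
  rw [← map_mul, ← map_mul, mul_comm]
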